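/- Let k ≥ 2. Every conjugate of T_k has canonical length at least 4k−1; equivalently, for every y ∈ B₅ conjugate to T_k and all integers p ≤ q with Δᵖ ≼ y and y ≼ Δ^q, one has q − p ≥ 4k−1. Since the canonical length of T_k itself equals 4k−1, the braid T_k belongs to its own super summit set. -/

import Mathlib

/-- Defining relations of the braid group on 5 strands, as elements of the
free group on four generators (generator `i` corresponds to `σ_{i+1}`). -/
def braidRels : Set (FreeGroup (Fin 4)) :=
  { r | (∃ i : Fin 3, r = FreeGroup.of i.castSucc * FreeGroup.of i.succ * FreeGroup.of i.castSucc *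
          (FreeGroup.of i.succ * FreeGroup.of i.castSucc * FreeGroup.of i.succ)⁻¹) ∨
        (∃ i j : Fin 4, 2 ≤ |(i : ℤ) - (j : ℤ)| ∧
          r = FreeGroup.of i * FreeGroup.of j * (FreeGroup.of j * FreeGroup.of i)⁻¹) }

/-- The Artin braid group on 5 strands. -/
abbrev B5 : Type := PresentedGroup braidRels

/-- The Artin generators (index `i` corresponds to `σ_{i+1}`). -/
def gen (i : Fin 4) : B5 := PresentedGroup.of i

def s1 : B5 := gen 0
def s2 : B5 := gen 1
def s3 : B5 := gen 2
def s4 : B5 := gen 3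

/-- A braid is positive if it lies in the submonoid generated by `σ₁,…,σ₄`. -/
def IsPos (x : B5) : Prop := x ∈ Submonoid.closure (Set.range gen)

/-- Prefix order: `Pre x y` means `x ≼ y`, i.e. `x⁻¹ y` is positive. -/
def Pre (x y : B5) : Prop := IsPos (x⁻¹ * y)

/-- The half twist `Δ = σ₁σ₂σ₃σ₄σ₁σ₂σ₃σ₁σ₂σ₁`. -/
def Δ : B5 := s1*s2*s3*s4*s1*s2*s3*s1*s2*s1

def δ3 : B5 := s2*s1
def Δ3 : B5 := s2*s1*s2
def δt3 : B5 := s1*s2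

/-- A braid `s` is simple if `1 ≼ s ≼ Δ`. -/
def IsSimple (s : B5) : Prop := IsPos s ∧ Pre s Δ

/-- Two simple braids `s, t` are left-weighted if no generator `σᵢ` is such that
`s σᵢ` and `σᵢ⁻¹ t` are both simple. -/
def LeftWeighted (s t : B5) : Prop :=
  ¬ ∃ i : Fin 4, IsSimple (s * gen i) ∧ IsSimple ((gen i)⁻¹ * t)

/-- The canonical length of `z`: the minimum of `q - p` over `p ≤ q` with
`Δ^p ≼ z` and `z ≼ Δ^q`. -/
noncomputable def canLen (z : B5) : ℕ :=
  sInf { n : ℕ | ∃ p q : ℤ, p ≤ q ∧ q - p = (n : ℤ) ∧ Pre (Δ ^ p) z ∧ Pre z (Δ ^ q) }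

/-- `y` belongs to the super summit set of `x`:
`y` is conjugate to `x` and has minimal canonical length among conjugates of `x`. -/
def InSSS (x y : B5) : Prop :=
  IsConj x y ∧ ∀ z : B5, IsConj x z → canLen y ≤ canLen z

/-- The braid `T_k = δ₃^{3k+1} σ₄^{2k+2} σ₃ σ₄^{2k-1}`. -/
def T (k : ℕ) : B5 := δ3 ^ (3*k+1) * s4 ^ (2*k+2) * s3 * s4 ^ (2*k-1)

/-- The braid `T'_k`, a rigid conjugate of `T_k`. -/
def T' (k : ℕ) : B5 :=
  (s1*s3)^(2*k-2) * (s3*s4*Δ3) * (Δ3*s4) * ((δ3*s4)*(δt3*s4))^(k-1) * (δ3*s4*s3*s4)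

/-! ### Positive words and braid moves -/

/-- The braid represented by a positive word. -/
def word (l : List (Fin 4)) : B5 := (l.map gen).prod

theorem word_cons (i : Fin 4) (l : List (Fin 4)) : word (i :: l) = gen i * word l := by
  simp [word]

theorem gen_far (i j : Fin 4) (h : 2 ≤ |(i : ℤ) - (j : ℤ)|) : gen i * gen j = gen j * gen i := by
  have := PresentedGroup.one_of_mem (rels := braidRels) (Or.inr ⟨i, j, h, rfl⟩)
  rw [map_mul, map_inv, mul_inv_eq_one, map_mul, map_mul] at this
  exact this

theorem gen_braid (i : Fin 3) :
    gen i.castSucc * gen i.succ * gen i.castSucc = gen i.succ * gen i.castSucc * gen i.succ := by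
  have := PresentedGroup.one_of_mem (rels := braidRels) (Or.inl ⟨i, rfl⟩)
  rw [map_mul, map_inv, mul_inv_eq_one, map_mul, map_mul, map_mul, map_mul] at this
  exact this

theorem gen_near (i j : Fin 4) (h : |(i : ℤ) - (j : ℤ)| = 1) :
    gen i * gen j * gen i = gen j * gen i * gen j := by
  have key : ∀ i j : Fin 4, |(i : ℤ) - (j : ℤ)| = 1 →
      ∃ k : Fin 3, (i = k.castSucc ∧ j = k.succ) ∨ (j = k.castSucc ∧ i = k.succ) := by decide
  obtain ⟨k, ⟨rfl, rfl⟩ | ⟨rfl, rfl⟩⟩ := key i j h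
  · exact gen_braid k
  · exact (gen_braid k).symm

/-- Apply a braid relation or a commutation at the given position of a word, if one applies. -/
def braidMove : ℕ → List (Fin 4) → List (Fin 4)
  | n + 1, i :: l => i :: braidMove n l
  | 0, i :: j :: l =>
    if 2 ≤ |(i : ℤ) - (j : ℤ)| then j :: i :: l
    else match l with
      | i' :: l' => if i' = i ∧ |(i : ℤ) - (j : ℤ)| = 1 then j :: i :: j :: l' else i :: j :: l
      | [] => i :: j :: l
  | _, l => l

theorem word_braidMove (n : ℕ) (l : List (Fin 4)) : word (braidMove n l) = word l := by
  fun_induction braidMove n l with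
  | case1 n i l ih => rw [word_cons, word_cons, ih]
  | case2 i j l h => simp only [word_cons, ← mul_assoc, gen_far i j h]
  | case3 i j i' l h h' =>
    obtain ⟨rfl, h'⟩ := h'
    simp only [word_cons, ← mul_assoc, gen_near _ _ h']
  | case4 => rfl
  | case5 => rfl
  | case6 => rfl

theorem word_eq_of_moves (ms : List ℕ) {l l' : List (Fin 4)}
    (h : ms.foldl (fun w m => braidMove m w) l = l') : word l = word l' := by
  subst h
  induction ms generalizing l with
  | nil => rfl
  | cons m ms ih => rw [List.foldl_cons, ← ih, word_braidMove]

/-! ### The Lawrence–Krammer representation -/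

/-- The pairs `i < j` of strands, indexing the basis of the Lawrence–Krammer representation. -/
def strandPair : Fin 10 → Fin 5 × Fin 5 :=
  ![(0, 1), (0, 2), (0, 3), (0, 4), (1, 2), (1, 3), (1, 4), (2, 3), (2, 4), (3, 4)]

/-- Constant coefficients of the (rescaled) Lawrence–Krammer matrices at `q = 1/2`. -/
def krammerConst (k : Fin 4) : Matrix (Fin 10) (Fin 10) ℤ := Matrix.of fun r s =>
  let a := k.castSucc
  let b := k.succ
  let i := (strandPair s).1
  let j := (strandPair s).2
  let r := strandPair r
  if i = a ∧ j = b then 0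
  else if j = a then (if r = (i, a) then 1 else 0) + (if r = (i, b) then 1 else 0)
  else if j = b then (if r = (i, a) then 2 else 0)
  else if i = a then (if r = (b, j) then 2 else 0)
  else if i = b then (if r = (a, j) then 1 else 0) + (if r = (b, j) then 1 else 0)
  else if r = (i, j) then 2 else 0

/-- Linear coefficients of the (rescaled) Lawrence–Krammer matrices at `q = 1/2`. -/
def krammerLin (k : Fin 4) : Matrix (Fin 10) (Fin 10) ℤ := Matrix.of fun r s =>
  let a := k.castSucc
  let b := k.succ
  let i := (strandPair s).1
  let j := (strandPair s).2
  if strandPair r ≠ (a, b) then 0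
  else if i = a ∧ j = b then 1
  else if i < a ∧ j = b then -1
  else if i = a ∧ b < j then -1
  else if i < a ∧ b < j then 1
  else 0

open Polynomial in
/-- The (rescaled) Lawrence–Krammer matrix of a generator, at `q = 1/2`. -/
noncomputable def krammer (k : Fin 4) : Matrix (Fin 10) (Fin 10) ℤ[X] :=
  (C : ℤ →+* ℤ[X]).mapMatrix (krammerConst k) +
    (X : ℤ[X]) • (C : ℤ →+* ℤ[X]).mapMatrix (krammerLin k)

theorem commute_linear {R E : Type*} [CommRing R] [Ring E] [Algebra R E] (x : R) {a b a' b' : E}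
    (h0 : a * a' = a' * a) (h1 : a * b' + b * a' = a' * b + b' * a) (h2 : b * b' = b' * b) :
    (a + x • b) * (a' + x • b') = (a' + x • b') * (a + x • b) := by
  have e (a b a' b' : E) : (a + x • b) * (a' + x • b') =
      a * a' + x • (a * b' + b * a') + x ^ 2 • (b * b') := by
    simp only [mul_add, add_mul, smul_mul_assoc, mul_smul_comm]
    module
  rw [e, e, h0, h1, h2]

theorem braid_linear {R E : Type*} [CommRing R] [Ring E] [Algebra R E] (x : R) {a b a' b' : E}
    (h0 : a * a' * a = a' * a * a')
    (h1 : a * a' * b + a * b' * a + b * a' * a = a' * a * b' + a' * b * a' + b' * a * a')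
    (h2 : a * b' * b + b * a' * b + b * b' * a = a' * b * b' + b' * a * b' + b' * b * a')
    (h3 : b * b' * b = b' * b * b') :
    (a + x • b) * (a' + x • b') * (a + x • b) = (a' + x • b') * (a + x • b) * (a' + x • b') := by
  have e (a b a' b' : E) : (a + x • b) * (a' + x • b') * (a + x • b) =
      a * a' * a + x • (a * a' * b + a * b' * a + b * a' * a)
        + x ^ 2 • (a * b' * b + b * a' * b + b * b' * a) + x ^ 3 • (b * b' * b) := by
    simp only [mul_add, add_mul, smul_mul_assoc, mul_smul_comm]
    module
  rw [e, e, h0, h1, h2, h3]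

theorem krammer_far (i j : Fin 4) (h : 2 ≤ |(i : ℤ) - (j : ℤ)|) :
    krammer i * krammer j = krammer j * krammer i := by
  have key : ∀ i j : Fin 4, 2 ≤ |(i : ℤ) - (j : ℤ)| →
      krammerConst i * krammerConst j = krammerConst j * krammerConst i ∧
      krammerConst i * krammerLin j + krammerLin i * krammerConst j =
        krammerConst j * krammerLin i + krammerLin j * krammerConst i ∧
      krammerLin i * krammerLin j = krammerLin j * krammerLin i := by decide +kernel
  obtain ⟨h0, h1, h2⟩ := key i j h
  apply commute_linear <;> simp only [← map_mul, ← map_add, h0, h1, h2]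

theorem krammer_braid (k : Fin 3) :
    krammer k.castSucc * krammer k.succ * krammer k.castSucc =
      krammer k.succ * krammer k.castSucc * krammer k.succ := by
  have key : ∀ k : Fin 3,
      let a := krammerConst k.castSucc
      let b := krammerLin k.castSucc
      let a' := krammerConst k.succ
      let b' := krammerLin k.succ
      a * a' * a = a' * a * a' ∧
      a * a' * b + a * b' * a + b * a' * a = a' * a * b' + a' * b * a' + b' * a * a' ∧
      a * b' * b + b * a' * b + b * b' * a = a' * b * b' + b' * a * b' + b' * b * a' ∧
      b * b' * b = b' * b * b' := by decide +kernel
  obtain ⟨h0, h1, h2, h3⟩ := key k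
  apply braid_linear <;> simp only [← map_mul, ← map_add, h0, h1, h2, h3]

theorem cubic_linear {R E : Type*} [CommRing R] [Ring E] [Algebra R E] (x : R) {a b : E}
    (h0 : a * a * a = a * a + (a + a))
    (h1 : a * a * b + a * b * a + b * a * a = a * b + b * a + (b + b) + a * a - a - (1 + 1))
    (h2 : a * b * b + b * a * b + b * b * a = b * b + a * b + b * a - b)
    (h3 : b * b * b = b * b) :
    (a + x • b) * ((1 + x) • (a + x • b) + (2 - x) • 1 - (a + x • b) * (a + x • b)) =
      (2 * x) • 1 := by
  have e : (a + x • b) * (a + x • b) * (a + x • b) =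
      a * a * a + x • (a * a * b + a * b * a + b * a * a)
        + x ^ 2 • (a * b * b + b * a * b + b * b * a) + x ^ 3 • (b * b * b) := by
    simp only [mul_add, add_mul, smul_mul_assoc, mul_smul_comm]
    module
  rw [mul_sub, ← mul_assoc, e, h0, h1, h2, h3]
  simp only [mul_add, add_mul, smul_mul_assoc, mul_smul_comm, mul_one]
  module

open Polynomial in
/-- The cubic relation satisfied by the generators of the Lawrence–Krammer representation. -/
theorem krammer_cubic (k : Fin 4) :
    krammer k * ((1 + X : ℤ[X]) • krammer k + (2 - X : ℤ[X]) • 1 - krammer k * krammer k) =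
      (2 * X : ℤ[X]) • 1 := by
  have key : ∀ k : Fin 4,
      let a := krammerConst k
      let b := krammerLin k
      a * a * a = a * a + (a + a) ∧
      a * a * b + a * b * a + b * a * a = a * b + b * a + (b + b) + a * a - a - (1 + 1) ∧
      a * b * b + b * a * b + b * b * a = b * b + a * b + b * a - b ∧
      b * b * b = b * b := by decide +kernel
  obtain ⟨h0, h1, h2, h3⟩ := key k
  apply cubic_linear <;>
    simp only [← map_mul, ← map_add, ← map_sub, ← map_one (C : ℤ →+* ℤ[X]).mapMatrix,
      h0, h1, h2, h3]

/-- Extension of scalars from `ℤ[X]` to its field of fractions, on matrices. -/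
noncomputable def toFrac : Matrix (Fin 10) (Fin 10) (Polynomial ℤ) →+*
    Matrix (Fin 10) (Fin 10) (FractionRing (Polynomial ℤ)) :=
  (algebraMap (Polynomial ℤ) (FractionRing (Polynomial ℤ))).mapMatrix

theorem toFrac_injective : Function.Injective toFrac := by
  intro M N h
  refine Matrix.ext fun i j => ?_
  exact IsFractionRing.injective (Polynomial ℤ) (FractionRing (Polynomial ℤ))
    (congrFun (congrFun h i) j)

theorem isUnit_toFrac_krammer (k : Fin 4) : IsUnit (toFrac (krammer k)) := by
  have h := congrArg toFrac (krammer_cubic k)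
  rw [map_mul] at h
  have hX : algebraMap (Polynomial ℤ) (FractionRing (Polynomial ℤ)) (2 * Polynomial.X) ≠ 0 := by
    rw [Ne, FaithfulSMul.algebraMap_eq_zero_iff]
    exact mul_ne_zero two_ne_zero Polynomial.X_ne_zero
  have hu : IsUnit (toFrac ((2 * Polynomial.X : Polynomial ℤ) • 1)) := by
    convert (IsUnit.mk0 _ hX).map (Matrix.scalar (Fin 10)) using 1
    ext i j
    by_cases hij : i = j <;> simp [toFrac, hij]
  rw [← h] at hu
  exact isUnit_of_mul_isUnit_left hu

/-- The Lawrence–Krammer representation (rescaled, at `q = 1/2`). -/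
noncomputable def krammerRep :
    B5 →* (Matrix (Fin 10) (Fin 10) (FractionRing (Polynomial ℤ)))ˣ :=
  PresentedGroup.toGroup (f := fun k => (isUnit_toFrac_krammer k).unit) (by
    rintro r (⟨k, rfl⟩ | ⟨i, j, h, rfl⟩)
    · rw [map_mul, map_inv, mul_inv_eq_one]
      ext1
      simpa using congrArg toFrac (krammer_braid k)
    · rw [map_mul, map_inv, mul_inv_eq_one]
      ext1
      simpa using congrArg toFrac (krammer_far i j h))

theorem krammerRep_gen (k : Fin 4) : (krammerRep (gen k) : Matrix _ _ _) = toFrac (krammer k) := by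
  simp [krammerRep, gen]

/-- `HasHead x N` says that the Lawrence–Krammer matrix of `x` has entries in `ℤ[X]`, with
matrix of constant coefficients `N`. -/
def HasHead (x : B5) (N : Matrix (Fin 10) (Fin 10) ℤ) : Prop :=
  ∃ M : Matrix (Fin 10) (Fin 10) (Polynomial ℤ), (krammerRep x : Matrix _ _ _) = toFrac M ∧
    Polynomial.constantCoeff.mapMatrix M = N

theorem HasHead.mul {x y : B5} {N P : Matrix (Fin 10) (Fin 10) ℤ} (hx : HasHead x N)
    (hy : HasHead y P) : HasHead (x * y) (N * P) := by
  obtain ⟨M, hM, rfl⟩ := hx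
  obtain ⟨M', hM', rfl⟩ := hy
  exact ⟨M * M', by rw [map_mul, Units.val_mul, hM, hM', map_mul], map_mul _ _ _⟩

theorem HasHead.one : HasHead 1 1 := ⟨1, by simp, map_one _⟩

theorem HasHead.unique {x : B5} {N P : Matrix (Fin 10) (Fin 10) ℤ} (h : HasHead x N)
    (h' : HasHead x P) : N = P := by
  obtain ⟨M, hM, rfl⟩ := h
  obtain ⟨M', hM', rfl⟩ := h'
  rw [toFrac_injective (hM.symm.trans hM')]

theorem hasHead_gen (k : Fin 4) : HasHead (gen k) (krammerConst k) := by
  refine ⟨krammer k, krammerRep_gen k, ?_⟩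
  ext i j
  simp [krammer]

theorem hasHead_word (l : List (Fin 4)) : HasHead (word l) (l.map krammerConst).prod := by
  induction l with
  | nil => exact HasHead.one
  | cons i l ih =>
    rw [word_cons, List.map_cons, List.prod_cons]
    exact (hasHead_gen i).mul ih

theorem IsPos.exists_hasHead {x : B5} (hx : IsPos x) : ∃ N, HasHead x N := by
  induction hx using Submonoid.closure_induction with
  | mem x hx => obtain ⟨k, rfl⟩ := hx; exact ⟨_, hasHead_gen k⟩
  | one => exact ⟨1, HasHead.one⟩
  | mul x y _ _ hx hy =>
    obtain ⟨N, hN⟩ := hx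
    obtain ⟨P, hP⟩ := hy
    exact ⟨_, hN.mul hP⟩

theorem Δ_eq_word : Δ = word [0, 1, 2, 3, 0, 1, 2, 0, 1, 0] := by
  simp [Δ, word, s1, s2, s3, s4, mul_assoc]

theorem hasHead_Δ : HasHead Δ 0 := by
  have h : (([0, 1, 2, 3, 0, 1, 2, 0, 1, 0] : List (Fin 4)).map krammerConst).prod = 0 := by
    decide +kernel
  rw [Δ_eq_word, ← h]
  exact hasHead_word _

/-- `Reach x i j` says that the matrix of constant coefficients of the Lawrence–Krammer matrix
of `x` is nonnegative, with a positive entry at `(i, j)`. -/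
def Reach (x : B5) (i j : Fin 10) : Prop :=
  ∃ N, HasHead x N ∧ (∀ a b, 0 ≤ N a b) ∧ 0 < N i j

theorem Reach.mul {x y : B5} {i j l : Fin 10} (hx : Reach x i j) (hy : Reach y j l) :
    Reach (x * y) i l := by
  obtain ⟨N, hN, hN0, hN1⟩ := hx
  obtain ⟨P, hP, hP0, hP1⟩ := hy
  refine ⟨N * P, hN.mul hP, fun a b => ?_, ?_⟩
  · rw [Matrix.mul_apply]
    exact Finset.sum_nonneg fun c _ => mul_nonneg (hN0 a c) (hP0 c b)
  · rw [Matrix.mul_apply]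
    exact Finset.sum_pos' (fun c _ => mul_nonneg (hN0 i c) (hP0 c l))
      ⟨j, Finset.mem_univ j, mul_pos hN1 hP1⟩

theorem Reach.pow {x : B5} {i : Fin 10} (hx : Reach x i i) (n : ℕ) : Reach (x ^ n) i i := by
  induction n with
  | zero =>
    refine ⟨1, by simpa using HasHead.one, fun a b => ?_, by simp⟩
    rw [Matrix.one_apply]
    split_ifs <;> simp
  | succ n ih => exact pow_succ x n ▸ ih.mul hx

theorem krammerConst_nonneg (k : Fin 4) (a b : Fin 10) : 0 ≤ krammerConst k a b := by
  simp only [krammerConst, Matrix.of_apply]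
  split_ifs <;> simp

theorem reach_word (l : List (Fin 4)) (i j : Fin 10)
    (h : 0 < (l.map krammerConst).prod i j) : Reach (word l) i j := by
  refine ⟨_, hasHead_word l, ?_, h⟩
  clear h
  induction l with
  | nil =>
    intro a b
    rw [List.map_nil, List.prod_nil, Matrix.one_apply]
    split_ifs <;> simp
  | cons k l ih =>
    intro a b
    rw [List.map_cons, List.prod_cons]
    rw [Matrix.mul_apply]
    exact Finset.sum_nonneg fun c _ => mul_nonneg (krammerConst_nonneg k a c) (ih c b)

/-- A braid with nonzero head has infimum at most `0`. -/
theorem Reach.nonpos_of_pre {x : B5} {i j : Fin 10} (hx : Reach x i j) {n : ℤ}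
    (hn : Pre (Δ ^ n) x) : n ≤ 0 := by
  by_contra! hpos
  obtain ⟨m, rfl⟩ : ∃ m : ℕ, n = m + 1 := ⟨(n - 1).toNat, by omega⟩
  obtain ⟨N, hN, -, hpos⟩ := hx
  obtain ⟨P, hP⟩ := hn.exists_hasHead
  have hm : ∃ Q, HasHead (Δ ^ m) Q := by
    clear hP hn hpos
    induction m with
    | zero => exact ⟨1, by simpa using HasHead.one⟩
    | succ m ih =>
      obtain ⟨Q, hQ⟩ := ih (by omega)
      exact ⟨_, pow_succ Δ m ▸ hQ.mul hasHead_Δ⟩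
  obtain ⟨Q, hQ⟩ := hm
  have h := (hQ.mul hasHead_Δ).mul hP
  rw [← pow_succ, ← zpow_natCast, Nat.cast_succ, mul_inv_cancel_left] at h
  rw [hN.unique h, mul_zero, zero_mul] at hpos
  exact lt_irrefl _ hpos

/-! ### Conjugation by the half twist -/

theorem isPos_word (l : List (Fin 4)) : IsPos (word l) :=
  Submonoid.list_prod_mem _ (by
    intro x hx
    obtain ⟨i, -, rfl⟩ := List.mem_map.1 hx
    exact Submonoid.subset_closure ⟨i, rfl⟩)

theorem isPos_gen (i : Fin 4) : IsPos (gen i) := Submonoid.subset_closure ⟨i, rfl⟩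

theorem IsPos.mul {x y : B5} (hx : IsPos x) (hy : IsPos y) : IsPos (x * y) := mul_mem hx hy

theorem IsPos.pow {x : B5} (hx : IsPos x) (n : ℕ) : IsPos (x ^ n) := pow_mem hx n

theorem isPos_Δ : IsPos Δ := Δ_eq_word ▸ isPos_word _

theorem Δ_mul_gen (i : Fin 4) : Δ * gen i = gen i.rev * Δ := by
  have h1 : Δ * gen i = word ([0, 1, 2, 3, 0, 1, 2, 0, 1, 0] ++ [i]) := by
    simp [Δ_eq_word, word, mul_assoc]
  have h2 : gen i.rev * Δ = word (i.rev :: [0, 1, 2, 3, 0, 1, 2, 0, 1, 0]) := by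
    rw [word_cons, ← Δ_eq_word]
  rw [h1, h2]
  fin_cases i
  · exact word_eq_of_moves [7, 5, 4, 2, 1, 0] (by decide)
  · exact word_eq_of_moves [6, 4, 3, 1, 0, 8] (by decide)
  · exact word_eq_of_moves [3, 2, 0, 6, 9, 7, 5, 7] (by decide)
  · exact word_eq_of_moves [3, 2, 4, 9, 8, 7, 5, 3, 1, 3, 5, 4] (by decide)

theorem exists_gen_mul_eq_Δ (i : Fin 4) : ∃ y, IsPos y ∧ gen i * y = Δ := by
  have key (l : List (Fin 4)) (ms : List ℕ)
      (h : ms.foldl (fun w m => braidMove m w) (i :: l) = [0, 1, 2, 3, 0, 1, 2, 0, 1, 0]) :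
      ∃ y, IsPos y ∧ gen i * y = Δ :=
    ⟨word l, isPos_word l, by rw [← word_cons, Δ_eq_word, word_eq_of_moves ms h]⟩
  fin_cases i
  · exact key [1, 0, 2, 1, 0, 3, 2, 1, 0] [2, 5, 4, 3, 6] (by decide)
  · exact key [0, 1, 2, 1, 0, 3, 2, 1, 0] [0, 2, 5, 4, 3, 6] (by decide)
  · exact key [0, 1, 0, 2, 1, 3, 2, 1, 0] [0, 3, 1, 3, 5, 4, 3, 6] (by decide)
  · exact key [0, 1, 0, 2, 1, 0, 3, 2, 1] [0, 1, 2, 6, 5, 3, 2, 3, 7, 5, 7] (by decide)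

/-- Conjugation by the half twist. -/
def braidFlip : B5 ≃* B5 := MulAut.conj Δ

theorem braidFlip_apply (x : B5) : braidFlip x = Δ * x * Δ⁻¹ := rfl

theorem braidFlip_mul_Δ (x : B5) : braidFlip x * Δ = Δ * x := by simp [braidFlip_apply]

theorem braidFlip_gen (i : Fin 4) : braidFlip (gen i) = gen i.rev := by
  rw [braidFlip_apply, Δ_mul_gen, mul_inv_cancel_right]

theorem braidFlip_word (l : List (Fin 4)) : braidFlip (word l) = word (l.map Fin.rev) := by
  induction l with
  | nil => exact map_one _
  | cons i l ih => rw [word_cons, map_mul, ih, braidFlip_gen, List.map_cons, word_cons]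

theorem braidFlip_braidFlip (x : B5) : braidFlip (braidFlip x) = x := by
  have h : (braidFlip.trans braidFlip).toMonoidHom = MonoidHom.id B5 :=
    PresentedGroup.ext fun i => by
      change braidFlip (braidFlip (gen i)) = gen i
      rw [braidFlip_gen, braidFlip_gen, Fin.rev_rev]
  exact DFunLike.congr_fun h x

theorem commute_Δ_sq (x : B5) : Commute (Δ ^ 2) x := by
  have h : Δ * Δ * x = x * (Δ * Δ) := by
    rw [mul_assoc, ← braidFlip_mul_Δ x, ← mul_assoc, ← braidFlip_mul_Δ, braidFlip_braidFlip,
      mul_assoc]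
  rwa [← sq] at h

theorem commute_Δ_pow_even {n : ℕ} (hn : Even n) (x : B5) : Commute (Δ ^ n) x := by
  obtain ⟨m, rfl⟩ := hn
  rw [← two_mul, pow_mul]
  exact (commute_Δ_sq x).pow_left m

theorem IsPos.map_braidFlip {x : B5} (hx : IsPos x) : IsPos (braidFlip x) := by
  induction hx using Submonoid.closure_induction with
  | mem x hx => obtain ⟨i, rfl⟩ := hx; exact braidFlip_gen i ▸ isPos_gen _
  | one => rw [map_one]; exact one_mem _
  | mul x y _ _ hx hy => rw [map_mul]; exact hx.mul hy

theorem IsPos.conj_Δ_zpow {x : B5} (hx : IsPos x) (n : ℤ) : IsPos (Δ ^ n * x * (Δ ^ n)⁻¹) := by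
  have hinv (y : B5) : Δ⁻¹ * y * Δ = braidFlip y := by
    conv_lhs => rw [← braidFlip_braidFlip y, mul_assoc, braidFlip_mul_Δ, inv_mul_cancel_left]
  induction n using Int.induction_on with
  | zero => simpa using hx
  | succ n ih =>
    convert ih.map_braidFlip using 1
    rw [braidFlip_apply]
    group
  | pred n ih =>
    convert ih.map_braidFlip using 1
    rw [← hinv]
    group

/-! ### Infimum and supremum -/

theorem Pre.mul {x y : B5} {a b : ℤ} (hx : Pre (Δ ^ a) x) (hy : Pre (Δ ^ b) y) :
    Pre (Δ ^ (a + b)) (x * y) := by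
  have h := (IsPos.conj_Δ_zpow hx (-b)).mul hy
  rw [Pre]
  convert h using 1
  group

theorem IsPos.pre {x : B5} (hx : IsPos x) : Pre (Δ ^ (0 : ℤ)) x := by
  simpa [Pre] using hx

theorem Pre.pow {x : B5} {a : ℤ} (hx : Pre (Δ ^ a) x) (m : ℕ) : Pre (Δ ^ (m * a)) (x ^ m) := by
  induction m with
  | zero => simpa using IsPos.pre (one_mem _)
  | succ m ih =>
    convert ih.mul hx using 1
    · push_cast
      ring_nf
    · exact pow_succ x m

theorem Pre.mono {x : B5} {a b : ℤ} (hx : Pre (Δ ^ a) x) (h : b ≤ a) : Pre (Δ ^ b) x := by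
  obtain ⟨n, rfl⟩ := Int.le.dest h
  unfold Pre at hx ⊢
  convert (isPos_Δ.pow n).mul hx using 1
  rw [← zpow_natCast]
  group

theorem pre_Δ_zpow_self (n : ℤ) : Pre (Δ ^ n) (Δ ^ n) := by
  rw [Pre, inv_mul_cancel]
  exact one_mem _

theorem pre_Δ_zpow_iff {x : B5} {q : ℤ} : Pre x (Δ ^ q) ↔ Pre (Δ ^ (-q)) x⁻¹ := by
  unfold Pre
  constructor <;> intro h
  · convert IsPos.conj_Δ_zpow h q using 1
    group
  · convert IsPos.conj_Δ_zpow h (-q) using 1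
    group

theorem exists_pre (x : B5) : ∃ n : ℤ, Pre (Δ ^ n) x := by
  suffices h : (∃ n : ℤ, Pre (Δ ^ n) x) ∧ ∃ n : ℤ, Pre (Δ ^ n) x⁻¹ from h.1
  have hx : x ∈ Subgroup.closure (Set.range gen) := by
    have := PresentedGroup.closure_range_of braidRels
    exact this ▸ Subgroup.mem_top x
  induction hx using Subgroup.closure_induction with
  | mem x hx =>
    obtain ⟨i, rfl⟩ := hx
    refine ⟨⟨0, (isPos_gen i).pre⟩, -1, ?_⟩
    obtain ⟨y, hy, h⟩ := exists_gen_mul_eq_Δ i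
    rw [← pre_Δ_zpow_iff, zpow_one, Pre, ← h, inv_mul_cancel_left]
    exact hy
  | one => exact ⟨⟨0, IsPos.pre (one_mem _)⟩, 0, inv_one (G := B5) ▸ IsPos.pre (one_mem _)⟩
  | mul x y _ _ hx hy =>
    obtain ⟨⟨a, ha⟩, b, hb⟩ := hx
    obtain ⟨⟨c, hc⟩, d, hd⟩ := hy
    exact ⟨⟨_, ha.mul hc⟩, _, mul_inv_rev x y ▸ hd.mul hb⟩
  | inv x _ hx => exact ⟨hx.2, by simpa using hx.1⟩

/-- An upper bound on the infima of all powers of `x` that is linear in the exponent bounds the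
infimum of every conjugate of `x`. -/
theorem le_of_pre_of_isConj {x y : B5} {a p : ℤ}
    (hx : ∀ (m : ℕ) (n : ℤ), Pre (Δ ^ n) (x ^ m) → n ≤ m * a) (hxy : IsConj x y)
    (hy : Pre (Δ ^ p) y) : p ≤ a := by
  obtain ⟨c, rfl⟩ := isConj_iff.1 hxy
  obtain ⟨d, hd⟩ := exists_pre c⁻¹
  obtain ⟨e, he⟩ := exists_pre c
  by_contra! hlt
  set m := (d + e).natAbs + 1
  have h := (hd.mul (hy.pow m)).mul he
  rw [conj_pow] at h
  have h' := hx m _ (by simpa [mul_assoc] using h)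
  have hm : (m : ℤ) * 1 ≤ m * (p - a) := by gcongr; omega
  have : (m : ℤ) = |d + e| + 1 := by simp [m]
  have := neg_abs_le (d + e)
  linarith [mul_sub (m : ℤ) p a]

theorem exists_pre_pre (z : B5) :
    ∃ p q : ℤ, p ≤ q ∧ Pre (Δ ^ p) z ∧ Pre z (Δ ^ q) := by
  obtain ⟨p, hp⟩ := exists_pre z
  obtain ⟨q, hq⟩ := exists_pre z⁻¹
  exact ⟨min p (-q), -q, min_le_right _ _, hp.mono (min_le_left _ _),
    pre_Δ_zpow_iff.2 (by simpa using hq)⟩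

theorem le_canLen {z : B5} {N : ℕ}
    (h : ∀ p q : ℤ, p ≤ q → Pre (Δ ^ p) z → Pre z (Δ ^ q) → (N : ℤ) ≤ q - p) : N ≤ canLen z := by
  obtain ⟨p, q, hpq, hp, hq⟩ := exists_pre_pre z
  refine le_csInf ⟨(q - p).toNat, p, q, hpq, by omega, hp, hq⟩ ?_
  rintro n ⟨p, q, hpq, hn, hp, hq⟩
  exact_mod_cast hn ▸ h p q hpq hp hq

/-! ### The braids `T k` -/

theorem word_mul_word_eq_Δ (ms : List ℕ) {l l' : List (Fin 4)}
    (h : ms.foldl (fun w m => braidMove m w) (l ++ l') = [0, 1, 2, 3, 0, 1, 2, 0, 1, 0]) :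
    word l * word l' = Δ := by
  rw [Δ_eq_word, ← word_eq_of_moves ms h, word, word, word, List.map_append, List.prod_append]

theorem pow_mul_complement_pow {x y : B5} (h : x * y = Δ) (m : ℕ) :
    x ^ (2 * m) * (y * braidFlip y) ^ m = Δ ^ (2 * m) := by
  have hy : y = x⁻¹ * Δ := by rw [← h, inv_mul_cancel_left]
  have hy2 : y * braidFlip y = (x ^ 2)⁻¹ * Δ ^ 2 := by
    have := (commute_Δ_sq x⁻¹).eq
    rw [braidFlip_apply, hy, ← inv_pow, sq x⁻¹, mul_assoc x⁻¹ x⁻¹, ← this, sq]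
    group
  rw [hy2, ((commute_Δ_sq _).symm).mul_pow, pow_mul, pow_mul, inv_pow, mul_inv_cancel_left]

theorem T_add_two (n : ℕ) :
    T (n + 2) = word [1, 0, 1, 3] ^ (2 * (n + 2)) * word [1, 0, 3, 2] * word [2] ^ (2 * n + 1) *
      word [2, 3, 2] := by
  have hδ : Commute δ3 s4 := by
    have h0 : Commute s1 s4 := gen_far 0 3 (by decide)
    have h1 : Commute s2 s4 := gen_far 1 3 (by decide)
    exact h1.mul_left h0
  have hΔ3 : Commute Δ3 s4 := hδ.mul_left (gen_far 1 3 (by decide))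
  have hcube : δ3 ^ 3 = Δ3 ^ 2 := by
    have := word_eq_of_moves [3] (l := [1, 0, 1, 0, 1, 0]) (l' := [1, 0, 1, 1, 0, 1]) (by decide)
    simpa [word, δ3, Δ3, s1, s2, pow_succ, mul_assoc] using this
  have hswap : SemiconjBy (s4 * s3) s4 s3 := by
    have := gen_near 3 2 (by decide)
    rw [SemiconjBy, ← mul_assoc]
    exact this
  have hswap' := (hswap.pow_right (2 * n + 3)).eq
  have hA : word [1, 0, 1, 3] = Δ3 * s4 := by simp [word, Δ3, s1, s2, s4, mul_assoc]
  have hB : word [1, 0, 3, 2] = δ3 * s4 * s3 := by simp [word, δ3, s1, s2, s3, s4, mul_assoc]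
  have hE : word [2] = s3 := by simp [word, s3]
  have hC : word [2, 3, 2] = s3 * s4 * s3 := by simp [word, s3, s4, mul_assoc]
  rw [hA, hB, hC, hE, hΔ3.mul_pow, T]
  have he : 2 * (n + 2) - 1 = 2 * n + 3 := by omega
  rw [he, pow_succ δ3, pow_mul δ3, hcube, ← pow_mul]
  calc Δ3 ^ (2 * (n + 2)) * δ3 * s4 ^ (2 * (n + 2) + 2) * s3 * s4 ^ (2 * n + 3)
      = Δ3 ^ (2 * (n + 2)) * (δ3 * s4 ^ (2 * (n + 2))) * s4 * ((s4 * s3) * s4 ^ (2 * n + 3)) := by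
        simp only [pow_add _ (2 * (n + 2)) 2, sq, mul_assoc]
    _ = _ := by
        have h3 : s3 ^ (2 * n + 3) = s3 * (s3 ^ (2 * n + 1) * s3) := by
          rw [← pow_succ, ← pow_succ']
        rw [hswap', (hδ.pow_right _).eq, h3]
        simp only [mul_assoc]

/-- The positive braid `(T (n + 2))⁻¹ * Δ ^ (4 * n + 7)`. -/
def coT (n : ℕ) : B5 :=
  word [0, 1, 0, 2, 1, 3, 2] *
    (word [3, 2, 3, 1, 2, 0, 1, 2, 3] * word [0, 1, 0, 2, 1, 3, 2, 1, 0]) ^ n *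
    word [3, 2, 3, 1, 2, 0, 1, 2, 3] * word [1, 0, 2, 3, 2, 1] *
    (word [1, 2, 3, 0, 1, 2] * word [2, 1, 0, 3, 2, 1]) ^ (n + 2)

theorem T_mul_coT (n : ℕ) : T (n + 2) * coT n = Δ ^ (4 * n + 7) := by
  have hA : word [1, 0, 1, 3] * word [2, 1, 0, 3, 2, 1] = Δ :=
    word_mul_word_eq_Δ [0, 6, 5, 3, 2, 3, 7, 5, 7] (by decide)
  have hB : word [1, 0, 3, 2] * word [1, 0, 2, 3, 2, 1] = Δ :=
    word_mul_word_eq_Δ [5, 3, 2, 0, 6, 5, 3, 2, 3, 7, 5, 7] (by decide)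
  have hC : word [2, 3, 2] * word [0, 1, 0, 2, 1, 3, 2] = Δ :=
    word_mul_word_eq_Δ [2, 1, 0, 5, 3, 2, 5, 7, 6, 5, 3, 1, 3, 5, 8, 6, 4, 6] (by decide)
  have hE : word [2] * word [0, 1, 0, 2, 1, 3, 2, 1, 0] = Δ :=
    word_mul_word_eq_Δ [0, 3, 1, 3, 5, 4, 3, 6] (by decide)
  have hA' : braidFlip (word [2, 1, 0, 3, 2, 1]) = word [1, 2, 3, 0, 1, 2] := braidFlip_word _
  have hE' : braidFlip (word [0, 1, 0, 2, 1, 3, 2, 1, 0]) = word [3, 2, 3, 1, 2, 0, 1, 2, 3] :=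
    braidFlip_word _
  rw [T_add_two, coT, ← hA', ← hE']
  generalize word [1, 0, 1, 3] = A at *
  generalize word [2, 1, 0, 3, 2, 1] = a at *
  generalize word [1, 0, 3, 2] = B at *
  generalize word [1, 0, 2, 3, 2, 1] = b at *
  generalize word [2, 3, 2] = C at *
  generalize word [0, 1, 0, 2, 1, 3, 2] = c at *
  generalize word [2] = E at *
  generalize word [0, 1, 0, 2, 1, 3, 2, 1, 0] = e at *
  have hswap (x : B5) (m : ℕ) : Δ * (braidFlip x * x) ^ m = (x * braidFlip x) ^ m * Δ := by
    have h : SemiconjBy Δ (braidFlip x * x) (x * braidFlip x) := by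
      rw [SemiconjBy, ← braidFlip_mul_Δ, map_mul, braidFlip_braidFlip]
    exact (h.pow_right m).eq
  have hcent (m : ℕ) (x : B5) : x * Δ ^ (2 * m) = Δ ^ (2 * m) * x :=
    (commute_Δ_pow_even (even_two_mul m) x).symm.eq
  have hflip (x : B5) : Δ * braidFlip x = x * Δ := by
    rw [← braidFlip_mul_Δ, braidFlip_braidFlip]
  calc A ^ (2 * (n + 2)) * B * E ^ (2 * n + 1) * C *
        (c * (braidFlip e * e) ^ n * braidFlip e * b * (braidFlip a * a) ^ (n + 2))
      = A ^ (2 * (n + 2)) * B * E ^ (2 * n + 1) *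
        (C * c * (braidFlip e * e) ^ n * braidFlip e) * b * (braidFlip a * a) ^ (n + 2) := by
        simp only [mul_assoc]
    _ = A ^ (2 * (n + 2)) * B * (E * (E ^ (2 * n) * (e * braidFlip e) ^ n) * e * Δ) * b *
        (braidFlip a * a) ^ (n + 2) := by
        rw [hC, hswap, mul_assoc _ Δ, hflip, pow_succ' E]
        simp only [mul_assoc]
    _ = A ^ (2 * (n + 2)) * (B * Δ ^ (2 * (n + 1))) * b * (braidFlip a * a) ^ (n + 2) := by
        rw [pow_mul_complement_pow hE, hcent, mul_assoc _ E e, hE, mul_add 2 n 1, mul_one,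
          pow_add Δ, sq Δ]
        simp only [mul_assoc]
    _ = A ^ (2 * (n + 2)) * Δ ^ (2 * (n + 1)) * (Δ * (braidFlip a * a) ^ (n + 2)) := by
        rw [hcent, ← hB]
        simp only [mul_assoc]
    _ = Δ ^ (2 * (n + 1)) * (A ^ (2 * (n + 2)) * (a * braidFlip a) ^ (n + 2)) * Δ := by
        rw [hcent, hswap]
        simp only [mul_assoc]
    _ = Δ ^ (4 * n + 7) := by
        rw [pow_mul_complement_pow hA, ← pow_add, ← pow_succ]
        congr 1
        ring

theorem isPos_coT (n : ℕ) : IsPos (coT n) :=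
  ((((isPos_word _).mul (((isPos_word _).mul (isPos_word _)).pow _)).mul (isPos_word _)).mul
    (isPos_word _)).mul (((isPos_word _).mul (isPos_word _)).pow _)

theorem isPos_T (k : ℕ) : IsPos (T k) :=
  (((((isPos_gen 1).mul (isPos_gen 0)).pow _).mul ((isPos_gen 3).pow _)).mul (isPos_gen 2)).mul
    ((isPos_gen 3).pow _)

theorem reach_T (n : ℕ) : Reach (T (n + 2)) 5 5 := by
  have h3 : s3 = word [2] := by simp [word, s3]
  have h4 : s4 = word [3] := by simp [word, s4]
  have hδ3 : Reach (δ3 ^ 3) 5 5 := by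
    have : δ3 ^ 3 = word [1, 0, 1, 0, 1, 0] := by simp [word, δ3, s1, s2, pow_succ, mul_assoc]
    exact this ▸ reach_word _ _ _ (by decide +kernel)
  have hδ4 : Reach (δ3 ^ 4) 5 5 := by
    have : δ3 ^ 4 = word [1, 0, 1, 0, 1, 0, 1, 0] := by
      simp [word, δ3, s1, s2, pow_succ, mul_assoc]
    exact this ▸ reach_word _ _ _ (by decide +kernel)
  have h56 : Reach s4 5 6 := h4 ▸ reach_word _ _ _ (by decide +kernel)
  have h55 : Reach s4 5 5 := h4 ▸ reach_word _ _ _ (by decide +kernel)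
  have h65 : Reach s4 6 5 := h4 ▸ reach_word _ _ _ (by decide +kernel)
  have h66 : Reach s3 6 6 := h3 ▸ reach_word _ _ _ (by decide +kernel)
  have e1 : 3 * (n + 2) + 1 = 4 + 3 * (n + 1) := by ring
  have e2 : 2 * (n + 2) + 2 = 2 * n + 5 + 1 := by ring
  have e3 : 2 * (n + 2) - 1 = 2 * n + 2 + 1 := by omega
  rw [T, e1, e2, e3, pow_add, pow_mul, pow_succ s4 (2 * n + 5),
    pow_succ' s4 (2 * n + 2)]
  exact (((hδ4.mul (hδ3.pow _)).mul ((h55.pow _).mul h56)).mul h66).mul (h65.mul (h55.pow _))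

theorem reach_coT_mul_braidFlip (n : ℕ) : Reach (coT n * braidFlip (coT n)) 9 9 := by
  refine Reach.mul (j := 0) ?_ ?_
  · refine ((((reach_word _ 9 4 ?_).mul
      (Reach.pow (i := 4) ((reach_word _ 4 7 ?_).mul (reach_word _ 7 4 ?_)) n)).mul
      (reach_word _ 4 7 ?_)).mul (reach_word _ 7 0 ?_)).mul
      (Reach.pow (i := 0) ((reach_word _ 0 9 ?_).mul (reach_word _ 9 0 ?_)) (n + 2)) <;>
    decide +kernel
  · simp only [coT, map_mul, map_pow, braidFlip_word]
    refine ((((reach_word _ 0 7 ?_).mul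
      (Reach.pow (i := 7) ((reach_word _ 7 4 ?_).mul (reach_word _ 4 7 ?_)) n)).mul
      (reach_word _ 7 4 ?_)).mul (reach_word _ 4 9 ?_)).mul
      (Reach.pow (i := 9) ((reach_word _ 9 0 ?_).mul (reach_word _ 0 9 ?_)) (n + 2)) <;>
    decide +kernel

theorem T_sq_inv (n : ℕ) :
    (T (n + 2))⁻¹ ^ 2 = coT n * braidFlip (coT n) * (Δ ^ (2 * (4 * n + 7)))⁻¹ := by
  rw [eq_mul_inv_iff_mul_eq, inv_pow, inv_mul_eq_iff_eq_mul, sq]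
  have h := T_mul_coT n
  have hc := (commute_Δ_pow_even (n := 4 * n + 8) ⟨2 * n + 4, by ring⟩ (T (n + 2))).symm.eq
  calc Δ ^ (2 * (4 * n + 7)) = Δ ^ (4 * n + 8) * Δ ^ (4 * n + 7) * Δ⁻¹ := by
        rw [eq_mul_inv_iff_mul_eq, ← pow_succ, ← pow_add]
        congr 1
        ring
    _ = T (n + 2) * (Δ ^ (4 * n + 7) * Δ) * coT n * Δ⁻¹ := by
        rw [← h, ← mul_assoc (Δ ^ _), ← hc, h, ← pow_succ]
    _ = T (n + 2) * T (n + 2) * (coT n * braidFlip (coT n)) := by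
        rw [← h, braidFlip_apply]
        simp only [mul_assoc]

theorem nonpos_of_pre_conj_T (n : ℕ) {y : B5} (hy : IsConj (T (n + 2)) y) {p : ℤ}
    (hp : Pre (Δ ^ p) y) : p ≤ 0 :=
  le_of_pre_of_isConj
    (fun m r h => by simpa using ((reach_T n).pow m).nonpos_of_pre h) hy hp

theorem le_of_conj_T_pre (n : ℕ) {y : B5} (hy : IsConj (T (n + 2)) y) {q : ℤ}
    (hq : Pre y (Δ ^ q)) : 4 * (n : ℤ) + 7 ≤ q := by
  have hinv : IsConj ((T (n + 2))⁻¹ ^ 2) (y⁻¹ ^ 2) := by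
    obtain ⟨c, rfl⟩ := isConj_iff.1 hy
    exact isConj_iff.2 ⟨c, by simp [sq, mul_assoc]⟩
  have h := le_of_pre_of_isConj (a := -(2 * (4 * (n : ℤ) + 7))) (fun m r hr => ?_) hinv
    ((pre_Δ_zpow_iff.1 hq).pow 2)
  · push_cast at h
    linarith
  · have hz := hr.mul (pre_Δ_zpow_self (m * (2 * (4 * n + 7))))
    have hcomm : Commute (coT n * braidFlip (coT n)) (Δ ^ (2 * (4 * n + 7)))⁻¹ :=
      (commute_Δ_pow_even (even_two_mul _) _).symm.inv_right
    have he : ((T (n + 2))⁻¹ ^ 2) ^ m * Δ ^ ((m : ℤ) * (2 * (4 * n + 7))) =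
        (coT n * braidFlip (coT n)) ^ m := by
      rw [T_sq_inv, hcomm.mul_pow, inv_pow, ← pow_mul, ← zpow_natCast Δ]
      push_cast
      rw [mul_comm (m : ℤ), inv_mul_cancel_right]
    rw [he] at hz
    have := ((reach_coT_mul_braidFlip n).pow m).nonpos_of_pre hz
    linarith

/-- every conjugate of `T_k` has canonical length at least `4k-1`:
for every conjugate `y` and all `p ≤ q` with `Δ^p ≼ y ≼ Δ^q` one has `q - p ≥ 4k-1`.
Since the canonical length of `T_k` equals `4k-1`, `T_k` belongs to its own super
summit set. -/
theorem Tk_in_SSS (k : ℕ) (hk : 2 ≤ k) :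
    (∀ y : B5, IsConj (T k) y → ∀ p q : ℤ, p ≤ q → Pre (Δ ^ p) y → Pre y (Δ ^ q) →
      4*(k:ℤ) - 1 ≤ q - p) ∧
    canLen (T k) = 4*k - 1 ∧
    InSSS (T k) (T k) := by
  obtain ⟨n, rfl⟩ : ∃ n, k = n + 2 := ⟨k - 2, by omega⟩
  have hlow (y : B5) (hy : IsConj (T (n + 2)) y) (p q : ℤ) (_ : p ≤ q) (hp : Pre (Δ ^ p) y)
      (hq : Pre y (Δ ^ q)) : 4 * ((n + 2 : ℕ) : ℤ) - 1 ≤ q - p := by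
    have h0 := nonpos_of_pre_conj_T n hy hp
    have h1 := le_of_conj_T_pre n hy hq
    push_cast
    linarith
  have hle (z : B5) (hz : IsConj (T (n + 2)) z) : 4 * (n + 2) - 1 ≤ canLen z :=
    le_canLen fun p q hpq hp hq => by
      have := hlow z hz p q hpq hp hq
      omega
  have hT : canLen (T (n + 2)) = 4 * (n + 2) - 1 := by
    refine le_antisymm (Nat.sInf_le ⟨0, 4 * n + 7, by omega, by omega, (isPos_T _).pre, ?_⟩)
      (hle _ (IsConj.refl _))
    have h : Δ ^ (4 * (n : ℤ) + 7) = Δ ^ (4 * n + 7) := by exact_mod_cast zpow_natCast Δ (4 * n + 7)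
    rw [Pre, h, ← T_mul_coT, inv_mul_cancel_left]
    exact isPos_coT n
  exact ⟨hlow, hT, IsConj.refl _, fun z hz => hT ▸ hle z hz⟩
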